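/- arXiv:2010.02875 — 2 statements merged into one kernel-verified Lean document; each statement's English description precedes it below -/
import Mathlib

section
/- Let G be an oriented graph on n vertices that contains no directed path with k edges. Then there is an ordering x_1, x_2, …, x_n of the vertex set such that for every i ∈ {1, …, n}, the number of in-neighbours of x_i among {x_{i+1}, …, x_n} is at most k − 1. -/
/-- An oriented graph: between any two vertices there is at most one directed edge
(in particular, no loops). -/
def IsOrientedGraph {V : Type*} (r : V → V → Prop) : Prop :=
  ∀ x y, r x y → ¬ r y x

/-- `p : Fin (k+1) → V` is a directed path with `k` edges for the edge relation `r`: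
`k + 1` distinct vertices with `p i → p (i+1)` for all `i`. -/
def IsDirPath {V : Type*} (r : V → V → Prop) {k : ℕ} (p : Fin (k + 1) → V) : Prop :=
  Function.Injective p ∧ ∀ i : Fin k, r (p i.castSucc) (p i.succ)

/-- If every vertex of the nonempty set `s` has at least `k` in-neighbours in `s`, then `s`
contains directed paths with any number `m ≤ k` of edges. -/
theorem exists_isDirPath_of_le_card_inNeighbors {V : Type*} {r : V → V → Prop}
    [DecidableRel r] (hirr : ∀ x, ¬ r x x) {s : Finset V} (hs : s.Nonempty) {k : ℕ}
    (hdeg : ∀ x ∈ s, k ≤ (s.filter (r · x)).card) (m : ℕ) (hm : m ≤ k) :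
    ∃ p : Fin (m + 1) → V, IsDirPath r p ∧ ∀ i, p i ∈ s := by
  classical
  induction m with
  | zero =>
    obtain ⟨x, hx⟩ := hs
    exact ⟨fun _ => x, ⟨fun _ _ _ => Subsingleton.elim (α := Fin 1) _ _, fun i => i.elim0⟩,
      fun _ => hx⟩
  | succ m ih =>
    obtain ⟨p, ⟨hinj, hadj⟩, hmem⟩ := ih (by omega)
    have hcard : (Finset.univ.image (p ∘ Fin.succ)).card < (s.filter (r · (p 0))).card := by
      have h₁ := Finset.card_image_le (s := Finset.univ) (f := p ∘ Fin.succ)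
      have h₂ := hdeg _ (hmem 0)
      simp only [Finset.card_univ, Fintype.card_fin] at h₁
      omega
    obtain ⟨y, hy, hyp⟩ := Finset.exists_mem_notMem_of_card_lt_card hcard
    rw [Finset.mem_filter] at hy
    have hnew : y ∉ Set.range p := by
      rintro ⟨i, rfl⟩
      induction i using Fin.cases with
      | zero => exact hirr _ hy.2
      | succ i => exact hyp (Finset.mem_image_of_mem (p ∘ Fin.succ) (Finset.mem_univ i))
    refine ⟨Fin.cons y p, ⟨Fin.cons_injective_iff.2 ⟨hnew, hinj⟩, fun i => ?_⟩, fun i => ?_⟩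
    · induction i using Fin.cases with
      | zero => exact hy.2
      | succ i => exact hadj i
    · induction i using Fin.cases with
      | zero => exact hy.1
      | succ i => exact hmem i

/-- If every nonempty set of vertices has a member with at most `d` in-neighbours in that set,
then any finite set of vertices can be ranked so that each member has at most `d` in-neighbours
of larger rank. -/
theorem exists_injOn_card_inNeighbors_le {V : Type*} {r : V → V → Prop} [DecidableRel r] {d : ℕ}
    (h : ∀ s : Finset V, s.Nonempty → ∃ x ∈ s, (s.filter (r · x)).card ≤ d) (s : Finset V) :
    ∃ f : V → ℕ, Set.InjOn f s ∧
      ∀ x ∈ s, (s.filter (fun y => f x < f y ∧ r y x)).card ≤ d := by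
  classical
  induction s using Finset.strongInduction with
  | H s ih =>
    rcases s.eq_empty_or_nonempty with rfl | hs
    · exact ⟨fun _ => 0, by simp, by simp⟩
    obtain ⟨x, hx, hxd⟩ := h s hs
    obtain ⟨f, hinj, hf⟩ := ih _ (Finset.erase_ssubset hx)
    refine ⟨fun y => if y = x then 0 else f y + 1, fun a ha b hb hab => ?_, fun a ha => ?_⟩
    · have := @hinj a
      grind
    · by_cases hax : a = x
      · subst hax
        exact (Finset.card_le_card fun y => by simp +contextual).trans hxd
      · refine (Finset.card_le_card fun y => ?_).trans (hf a (Finset.mem_erase.2 ⟨hax, ha⟩))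
        grind

/-- If an oriented graph `G` on `n` vertices contains no directed path with `k` edges,
then there is an ordering `x_1, …, x_n` of the vertices such that every `x_i` has at most
`k - 1` in-neighbours among `{x_{i+1}, …, x_n}`. -/
theorem ordering_of_path_free_oriented_graph
    {V : Type*} [Fintype V] (r : V → V → Prop) (k : ℕ)
    (hor : IsOrientedGraph r)
    (hnopath : ¬ ∃ p : Fin (k + 1) → V, IsDirPath r p) :
    ∃ e : Fin (Fintype.card V) ≃ V,
      ∀ i : Fin (Fintype.card V),
        {j : Fin (Fintype.card V) | i < j ∧ r (e j) (e i)}.ncard ≤ k - 1 := by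
  classical
  obtain ⟨f, hinj, hf⟩ := exists_injOn_card_inNeighbors_le (r := r) (d := k - 1) (by
    intro s hs
    by_contra! hdeg
    obtain ⟨p, hp, -⟩ := exists_isDirPath_of_le_card_inNeighbors
      (fun x hx => hor x x hx hx) hs (k := k) (fun x hx => by have := hdeg x hx; omega) k le_rfl
    exact hnopath ⟨p, hp⟩) Finset.univ
  have hinj : Function.Injective f := by simpa using hinj
  let _ : LinearOrder V := LinearOrder.lift' f hinj
  let e : Fin (Fintype.card V) ≃o V := Fintype.orderIsoFinOfCardEq V rfl
  refine ⟨e.toEquiv, fun i => ?_⟩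
  refine le_trans ?_ (hf (e i) (Finset.mem_univ _))
  rw [← Set.ncard_coe_finset]
  refine Set.ncard_le_ncard_of_injOn e (fun j hj => ?_) e.injective.injOn (Finset.finite_toSet _)
  have hlt : f (e i) < f (e j) := e.lt_iff_lt.2 hj.1
  simpa using ⟨hlt, hj.2⟩
end

section
/- Let 0 < 1/n ≪ ε ≪ δ ≤ 1/2. Let T be a tournament and let A, B be disjoint sets of vertices of T with |A| = |B| = n such that (A, B) is an (ε, d)-regular pair with δ ≤ d. Then the number of pairs of distinct vertices {x, y} ⊆ A that are not good (i.e., with |N⁺(x) ∩ N⁺(y) ∩ B| < (d² − 10ε)·n) is at most 10ε · C(n,2). -/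
/-- A tournament: a complete oriented graph. -/
def IsTournament {V : Type*} (r : V → V → Prop) : Prop :=
  (∀ x, ¬ r x x) ∧ ∀ x y, x ≠ y → (r x y ↔ ¬ r y x)

/-- The directed density from `A` to `B`: the number of edges directed from `A` to `B`
divided by `|A| * |B|` (which equals `n ^ 2` when `|A| = |B| = n`). -/
noncomputable def dirDensity {V : Type*} (r : V → V → Prop) (A B : Finset V) : ℝ :=
  ({p : V × V | p.1 ∈ A ∧ p.2 ∈ B ∧ r p.1 p.2}.ncard : ℝ) / ((A.card : ℝ) * (B.card : ℝ))

/-- `(A, B)` is an `(ε, d)`-regular pair: the directed density from `A` to `B` equals `d`,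
and for all `A' ⊆ A`, `B' ⊆ B` with `|A'| ≥ ε|A|`, `|B'| ≥ ε|B|`, the directed density
from `A'` to `B'` is within `ε` of `d`. -/
def IsRegularPair {V : Type*} (r : V → V → Prop) (ε d : ℝ) (A B : Finset V) : Prop :=
  dirDensity r A B = d ∧
  ∀ A' ⊆ A, ∀ B' ⊆ B, ε * (A.card : ℝ) ≤ (A'.card : ℝ) → ε * (B.card : ℝ) ≤ (B'.card : ℝ) →
    |dirDensity r A' B' - d| ≤ ε

section RegularPairs

open Finset
open scoped Classical

/-- The ordered pairs in `A ×ˢ B` satisfying `R` are counted row by row. -/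
theorem card_filter_product_eq_sum {V : Type*} (R : V → V → Prop) (A B : Finset V) :
    #{p ∈ A ×ˢ B | R p.1 p.2} = ∑ x ∈ A, #{z ∈ B | R x z} := by
  simp only [Finset.card_filter, Finset.sum_product]

theorem dirDensity_eq_sum {V : Type*} (r : V → V → Prop) (A B : Finset V) :
    dirDensity r A B = (∑ x ∈ A, (#{z ∈ B | r x z} : ℝ)) / ((#A : ℝ) * (#B : ℝ)) := by
  have h : {p : V × V | p.1 ∈ A ∧ p.2 ∈ B ∧ r p.1 p.2}
      = (({p ∈ A ×ˢ B | r p.1 p.2} : Finset (V × V)) : Set (V × V)) := by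
    ext p
    simp [and_assoc]
  rw [dirDensity, h, Set.ncard_coe_finset, card_filter_product_eq_sum]
  push_cast
  rfl

theorem dirDensity_le_one {V : Type*} (r : V → V → Prop) (A B : Finset V) :
    dirDensity r A B ≤ 1 := by
  rw [dirDensity_eq_sum]
  refine div_le_one_of_le₀ ?_ (by positivity)
  rw [← nsmul_eq_mul]
  exact Finset.sum_le_card_nsmul _ _ _ fun x _ => by exact_mod_cast Finset.card_filter_le _ _

/-- In a regular pair, few vertices of `A` have few out-neighbours in a large subset of `B`. -/
theorem IsRegularPair.card_low_degree_lt {V : Type*} {r : V → V → Prop} {ε d : ℝ}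
    {A B B' : Finset V} (h : IsRegularPair r ε d A B) (hε : 0 < ε) (hA : 0 < #A)
    (hsub : B' ⊆ B) (hB' : 0 < #B') (hcard : ε * (#B : ℝ) ≤ #B') :
    (#{x ∈ A | (#{z ∈ B' | r x z} : ℝ) < (d - ε) * #B'} : ℝ) < ε * #A := by
  by_contra! hge
  set A' := {x ∈ A | (#{z ∈ B' | r x z} : ℝ) < (d - ε) * #B'}
  have hApos : (0 : ℝ) < #A := by exact_mod_cast hA
  have hA'pos : (0 : ℝ) < #A' := (mul_pos hε hApos).trans_le hge
  have hB'pos : (0 : ℝ) < #B' := by exact_mod_cast hB'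
  have hreg := (abs_le.1 (h.2 A' (Finset.filter_subset _ _) B' hsub hge hcard)).1
  have hlt : ∑ x ∈ A', (#{z ∈ B' | r x z} : ℝ) < ∑ _x ∈ A', (d - ε) * #B' := by
    refine Finset.sum_lt_sum_of_nonempty ?_ fun x hx => (Finset.mem_filter.1 hx).2
    exact Finset.card_pos.1 (by exact_mod_cast hA'pos)
  have hdens : dirDensity r A' B' < d - ε := by
    rw [dirDensity_eq_sum, div_lt_iff₀ (mul_pos hA'pos hB'pos)]
    rw [Finset.sum_const, nsmul_eq_mul] at hlt
    linarith
  linarith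

/-- In a regular pair, all but at most `2 ε n ^ 2` ordered pairs of `A` have at least
`(d - ε) ^ 2 n` common out-neighbours in `B`. -/
theorem IsRegularPair.card_low_codegree_le {V : Type*} {r : V → V → Prop} {ε d : ℝ}
    {A B : Finset V} {n : ℕ} (h : IsRegularPair r ε d A B) (hε : 0 < ε) (hεd : 2 * ε ≤ d)
    (hn : 0 < n) (hA : #A = n) (hB : #B = n) :
    (#{p ∈ A ×ˢ A | (#{z ∈ B | r p.1 z ∧ r p.2 z} : ℝ) < (d - ε) ^ 2 * n} : ℝ)
      ≤ 2 * ε * (n : ℝ) ^ 2 := by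
  have hnpos : (0 : ℝ) < n := by exact_mod_cast hn
  have hd1 : d ≤ 1 := h.1 ▸ dirDensity_le_one r A B
  set L := {x ∈ A | (#{z ∈ B | r x z} : ℝ) < (d - ε) * n}
  have hLcard : (#L : ℝ) ≤ ε * n := by
    have := h.card_low_degree_lt hε (hA ▸ hn) subset_rfl (hB ▸ hn)
      (mul_le_of_le_one_left (by positivity) (by linarith))
    rw [hA, hB] at this
    exact this.le
  have hrow : ∀ x ∈ A,
      (#{y ∈ A | (#{z ∈ B | r x z ∧ r y z} : ℝ) < (d - ε) ^ 2 * n} : ℝ)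
        ≤ ε * n + if x ∈ L then (n : ℝ) else 0 := by
    intro x hx
    by_cases hxL : x ∈ L
    · rw [if_pos hxL]
      have : (#{y ∈ A | (#{z ∈ B | r x z ∧ r y z} : ℝ) < (d - ε) ^ 2 * n} : ℝ) ≤ n := by
        rw [← hA]
        exact_mod_cast Finset.card_filter_le _ _
      have := mul_pos hε hnpos
      linarith
    · rw [if_neg hxL, add_zero]
      have hdeg : (d - ε) * n ≤ (#{z ∈ B | r x z} : ℝ) := by
        by_contra! hlt
        exact hxL (Finset.mem_filter.2 ⟨hx, hlt⟩)
      have hlarge : ε * n ≤ (#{z ∈ B | r x z} : ℝ) :=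
        (mul_le_mul_of_nonneg_right (by linarith) hnpos.le).trans hdeg
      have hpos : 0 < #{z ∈ B | r x z} := by
        exact_mod_cast (mul_pos hε hnpos).trans_le hlarge
      have hlow := h.card_low_degree_lt hε (hA ▸ hn) (Finset.filter_subset _ _) hpos
        (by rwa [hB])
      rw [hA] at hlow
      refine le_trans ?_ hlow.le
      norm_cast
      refine Finset.card_le_card fun y hy => ?_
      rw [Finset.mem_filter] at hy ⊢
      refine ⟨hy.1, ?_⟩
      rw [Finset.filter_filter]
      have := mul_le_mul_of_nonneg_left hdeg (show 0 ≤ d - ε by linarith)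
      linarith [hy.2]
  rw [card_filter_product_eq_sum
    (fun x y => (#{z ∈ B | r x z ∧ r y z} : ℝ) < (d - ε) ^ 2 * n) A A]
  push_cast
  refine (Finset.sum_le_sum hrow).trans ?_
  have hLA : A.filter (· ∈ L) = L := by
    rw [Finset.filter_mem_eq_inter]
    exact Finset.inter_eq_right.2 (Finset.filter_subset _ _)
  rw [Finset.sum_add_distrib, ← Finset.sum_filter, hLA, Finset.sum_const, Finset.sum_const,
    nsmul_eq_mul, nsmul_eq_mul, hA]
  nlinarith [mul_le_mul_of_nonneg_right hLcard hnpos.le]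

end RegularPairs

/-- Let `0 < 1/n ≪ ε ≪ δ ≤ 1/2`, and let `(A, B)` be an `(ε, d)`-regular pair with
`δ ≤ d` and `|A| = |B| = n` in a tournament. Then the number of unordered pairs of
distinct vertices of `A` that are not good (fewer than `(d² - 10ε) n` common
out-neighbours in `B`) is at most `10 ε * C(n, 2)`. -/
theorem few_bad_pairs :
    ∀ δ : ℝ, 0 < δ → δ ≤ 1 / 2 →
    ∃ ε₀ : ℝ, 0 < ε₀ ∧
    ∀ ε : ℝ, 0 < ε → ε ≤ ε₀ →
    ∃ n₀ : ℕ, ∀ n : ℕ, n₀ ≤ n →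
    ∀ (V : Type) [Fintype V] (r : V → V → Prop), IsTournament r →
    ∀ (A B : Finset V) (d : ℝ), Disjoint A B → A.card = n → B.card = n →
      δ ≤ d → IsRegularPair r ε d A B →
      ({s : Sym2 V | ∃ x y : V, s = s(x, y) ∧ x ∈ A ∧ y ∈ A ∧ x ≠ y ∧
          ({z : V | z ∈ B ∧ r x z ∧ r y z}.ncard : ℝ) < (d ^ 2 - 10 * ε) * (n : ℝ)}.ncard : ℝ)
        ≤ 10 * ε * ((n.choose 2 : ℕ) : ℝ) := by
  classical
  intro δ hδ _
  refine ⟨δ / 2, by positivity, fun ε hε hεδ => ⟨2, ?_⟩⟩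
  intro n hn V _ r _ A B d _ hA hB hδd hreg
  have hd1 : d ≤ 1 := hreg.1 ▸ dirDensity_le_one r A B
  have hn2 : (2 : ℝ) ≤ n := by exact_mod_cast hn
  have hcount := hreg.card_low_codegree_le hε (by linarith) (by omega) hA hB
  set P := (A ×ˢ A).filter fun p =>
    ((B.filter fun z => r p.1 z ∧ r p.2 z).card : ℝ) < (d - ε) ^ 2 * n
  have hsub : {s : Sym2 V | ∃ x y : V, s = s(x, y) ∧ x ∈ A ∧ y ∈ A ∧ x ≠ y ∧
      ({z : V | z ∈ B ∧ r x z ∧ r y z}.ncard : ℝ) < (d ^ 2 - 10 * ε) * (n : ℝ)}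
      ⊆ ((P.image fun p => s(p.1, p.2) : Finset (Sym2 V)) : Set (Sym2 V)) := by
    rintro _ ⟨x, y, rfl, hx, hy, -, hlt⟩
    rw [← Finset.coe_filter, Set.ncard_coe_finset] at hlt
    refine Finset.mem_coe.2 (Finset.mem_image.2 ⟨(x, y), ?_, rfl⟩)
    refine Finset.mem_filter.2 ⟨Finset.mk_mem_product hx hy, hlt.trans_le ?_⟩
    refine mul_le_mul_of_nonneg_right ?_ (by positivity)
    nlinarith [sq_nonneg ε, mul_le_mul_of_nonneg_left hd1 hε.le]
  have hle : _ ≤ P.card := (Set.ncard_le_ncard hsub (Finset.finite_toSet _)).trans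
    ((Set.ncard_coe_finset _).trans_le Finset.card_image_le)
  refine (Nat.cast_le.2 hle).trans (hcount.trans ?_)
  rw [Nat.cast_choose_two]
  nlinarith [mul_nonneg hε.le (mul_nonneg (by linarith : (0 : ℝ) ≤ n)
    (by linarith : (0 : ℝ) ≤ 3 * n - 5))]
end
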